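/- Let i = √−1 ∈ ℂ. For every nonempty list c of integers with every entry ≥ 2, the complex numbers 𝓡(c)(i) and 𝓢(c)(i) (evaluations at q = i) both belong to the set {0, 1, −1, i, −i, 1+i, −(1+i), 1−i, −(1−i)}. Consequently, the remainder of 𝓢(c) upon division by q² + 1 in ℤ[q] is of the form a·q + b with a, b ∈ {0, 1, −1}. -/

import Mathlib

open Polynomial

/-- The `q`-deformation `[n]_q = 1 + q + ⋯ + q^{n-1}` of a nonnegative integer. -/
noncomputable def qNat (n : ℕ) : Polynomial ℤ := (Finset.range n).sum fun i => X ^ i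

/-- The matrix `M_q⁻(c) = (([c]_q, -q^{c-1}), (1, 0))` over `ℤ[q]`. -/
noncomputable def MqNeg (c : ℕ) : Matrix (Fin 2) (Fin 2) (Polynomial ℤ) :=
  !![qNat c, -(X ^ (c - 1)); 1, 0]

/-- `𝓡(c)`: the (0,0) entry of `M_q⁻(c₁)⋯M_q⁻(c_l)`. -/
noncomputable def Rpoly (L : List ℕ) : Polynomial ℤ := ((L.map MqNeg).prod) 0 0

/-- `𝓢(c)`: the (1,0) entry of `M_q⁻(c₁)⋯M_q⁻(c_l)`. -/
noncomputable def Spoly (L : List ℕ) : Polynomial ℤ := ((L.map MqNeg).prod) 1 0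

/-- `r(c) = 𝓡(c)(1)`. -/
noncomputable def rNum (L : List ℕ) : ℤ := (Rpoly L).eval 1

/-- `s(c) = 𝓢(c)(1)`. -/
noncomputable def sNum (L : List ℕ) : ℤ := (Spoly L).eval 1

lemma Rpoly_cons (c : ℕ) (L : List ℕ) :
    Rpoly (c :: L) = qNat c * Rpoly L - X ^ (c - 1) * Spoly L := by
  simp [Rpoly, Spoly, MqNeg, Matrix.mul_apply, Fin.sum_univ_two, sub_eq_add_neg]

lemma Spoly_cons (c : ℕ) (L : List ℕ) : Spoly (c :: L) = Rpoly L := by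
  simp [Rpoly, Spoly, MqNeg, Matrix.mul_apply, Fin.sum_univ_two]

lemma aeval_I_qNat_add_four (n : ℕ) :
    aeval Complex.I (qNat (n + 4)) = aeval Complex.I (qNat n) := by
  simp only [qNat, Finset.sum_range_succ, map_add, map_pow, aeval_X]
  linear_combination (Complex.I ^ n + Complex.I ^ (n + 1)) * Complex.I_sq

/-- The positive definite integral form `|R|² + |S|² - Re ((1 - i) R S̄)`, for `R = a + b i` and
`S = c + d i`, which every `M_q⁻(n)` preserves at `q = i`. -/
def gaussForm (a b c d : ℤ) : ℤ :=
  a ^ 2 + b ^ 2 + c ^ 2 + d ^ 2 - a * c - b * d - b * c + a * d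

/-- At `q = i` the entries of `M_q⁻(n + 1)` depend only on `n` modulo `4`. -/
lemma aeval_I_qNat_pow_cases (n : ℕ) :
    (aeval Complex.I (qNat (n + 1)) = 1 ∧ Complex.I ^ n = 1) ∨
    (aeval Complex.I (qNat (n + 1)) = 1 + Complex.I ∧ Complex.I ^ n = Complex.I) ∨
    (aeval Complex.I (qNat (n + 1)) = Complex.I ∧ Complex.I ^ n = -1) ∨
    (aeval Complex.I (qNat (n + 1)) = 0 ∧ Complex.I ^ n = -Complex.I) := by
  induction n using Nat.strong_induction_on with
  | _ n ih =>
    match n with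
    | 0 => simp [qNat]
    | 1 => simp [qNat, Finset.sum_range_succ]
    | 2 => right; right; left; simp [qNat, Finset.sum_range_succ]
    | 3 => right; right; right; simp [qNat, Finset.sum_range_succ, Complex.I_pow_three]
    | m + 4 =>
      rw [show m + 4 + 1 = m + 1 + 4 by ring, aeval_I_qNat_add_four, pow_add, Complex.I_pow_four,
        mul_one]
      exact ih m (by omega)

lemma exists_gaussForm_eq_one (L : List ℕ) (hL : ∀ y ∈ L, 1 ≤ y) :
    ∃ a b c d : ℤ, aeval Complex.I (Rpoly L) = a + b * Complex.I ∧
      aeval Complex.I (Spoly L) = c + d * Complex.I ∧ gaussForm a b c d = 1 := by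
  induction L with
  | nil => exact ⟨1, 0, 0, 0, by simp [Rpoly], by simp [Spoly], by simp [gaussForm]⟩
  | cons n L ih =>
    obtain ⟨a, b, c, d, hR, hS, hQ⟩ := ih fun y hy => hL y (List.mem_cons_of_mem _ hy)
    obtain ⟨m, rfl⟩ : ∃ m, n = m + 1 := ⟨n - 1, by have := hL n List.mem_cons_self; omega⟩
    have hI := Complex.I_sq
    unfold gaussForm at hQ
    simp only [Rpoly_cons, Spoly_cons, map_sub, map_mul, map_pow, aeval_X, hR, hS,
      Nat.add_sub_cancel]
    rcases aeval_I_qNat_pow_cases m with ⟨h, h'⟩ | ⟨h, h'⟩ | ⟨h, h'⟩ | ⟨h, h'⟩ <;> rw [h, h']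
    · exact ⟨a - c, b - d, a, b, by push_cast; ring, rfl, by unfold gaussForm; linarith⟩
    · exact ⟨a - b + d, a + b - c, a, b, by push_cast; linear_combination (b - d) * hI, rfl,
        by unfold gaussForm; linarith⟩
    · exact ⟨c - b, a + d, a, b, by push_cast; linear_combination b * hI, rfl,
        by unfold gaussForm; linarith⟩
    · exact ⟨-d, c, a, b, by push_cast; linear_combination d * hI, rfl,
        by unfold gaussForm; linarith⟩

lemma gaussForm_comm (a b c d : ℤ) : gaussForm c (-d) a (-b) = gaussForm a b c d := by
  unfold gaussForm; ring

lemma bounds_of_gaussForm_eq_one {a b c d : ℤ} (h : gaussForm a b c d = 1) :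
    (a = 0 ∨ a = 1 ∨ a = -1) ∧ (b = 0 ∨ b = 1 ∨ b = -1) := by
  unfold gaussForm at h
  have hab : a ^ 2 + b ^ 2 ≤ 2 := by
    nlinarith [sq_nonneg (2 * c - a - b), sq_nonneg (2 * d - b + a)]
  have ha : -1 ≤ a ∧ a ≤ 1 := by constructor <;> nlinarith
  have hb : -1 ≤ b ∧ b ≤ 1 := by constructor <;> nlinarith
  omega

lemma gaussian_mem_of_bounds {a b : ℤ} (ha : a = 0 ∨ a = 1 ∨ a = -1)
    (hb : b = 0 ∨ b = 1 ∨ b = -1) :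
    (a + b * Complex.I : ℂ) ∈
      ({0, 1, -1, Complex.I, -Complex.I, 1 + Complex.I, -(1 + Complex.I),
        1 - Complex.I, -(1 - Complex.I)} : Set ℂ) := by
  simp only [Set.mem_insert_iff, Set.mem_singleton_iff]
  rcases ha with rfl | rfl | rfl <;> rcases hb with rfl | rfl | rfl <;>
    simp [Complex.ext_iff]

/-- The value of an integral polynomial at `i` determines its remainder modulo `q² + 1`. -/
lemma modByMonic_X_sq_add_one_eq {p : ℤ[X]} {a b : ℤ}
    (h : aeval Complex.I p = a + b * Complex.I) : p %ₘ (X ^ 2 + 1) = C b * X + C a := by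
  have hm : (X ^ 2 + 1 : ℤ[X]).Monic := by monicity!
  have hdeg : (p %ₘ (X ^ 2 + 1)).degree ≤ 1 := by
    have h2 : (X ^ 2 + 1 : ℤ[X]).degree = 2 := by compute_degree!
    have hlt := degree_modByMonic_lt p hm
    rw [h2] at hlt
    exact Order.le_of_lt_succ hlt
  have heval : aeval Complex.I (p %ₘ (X ^ 2 + 1)) = a + b * Complex.I := by
    rw [← h, aeval_modByMonic_eq_self_of_root (by simp)]
  rw [eq_X_add_C_of_degree_le_one hdeg] at heval ⊢
  simp [Complex.ext_iff] at heval
  rw [heval.1, heval.2]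

/-- The values `𝓡(L)(i)` and `𝓢(L)(i)` lie in `{0, ±1, ±i, ±(1+i), ±(1−i)}`; consequently
the remainder of `𝓢(L)` modulo `q² + 1` is `a·q + b` with `a, b ∈ {0, ±1}`. -/
theorem stmt15 (L : List ℕ) (hL : L ≠ []) (hL2 : ∀ y ∈ L, 2 ≤ y) :
    ((Polynomial.aeval Complex.I) (Rpoly L) ∈
      ({0, 1, -1, Complex.I, -Complex.I, 1 + Complex.I, -(1 + Complex.I),
        1 - Complex.I, -(1 - Complex.I)} : Set ℂ) ∧
     (Polynomial.aeval Complex.I) (Spoly L) ∈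
      ({0, 1, -1, Complex.I, -Complex.I, 1 + Complex.I, -(1 + Complex.I),
        1 - Complex.I, -(1 - Complex.I)} : Set ℂ)) ∧
    ∃ a b : ℤ, (a = 0 ∨ a = 1 ∨ a = -1) ∧ (b = 0 ∨ b = 1 ∨ b = -1) ∧
      Spoly L %ₘ (X ^ 2 + 1) = C a * X + C b := by
  obtain ⟨a, b, c, d, hR, hS, hQ⟩ :=
    exists_gaussForm_eq_one L fun y hy => one_le_two.trans (hL2 y hy)
  obtain ⟨ha, hb⟩ := bounds_of_gaussForm_eq_one hQ
  obtain ⟨hc, hd⟩ := bounds_of_gaussForm_eq_one ((gaussForm_comm a b c d).trans hQ)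
  replace hd : d = 0 ∨ d = 1 ∨ d = -1 := by omega
  rw [hR, hS]
  exact ⟨⟨gaussian_mem_of_bounds ha hb, gaussian_mem_of_bounds hc hd⟩, d, c, hd, hc,
    modByMonic_X_sq_add_one_eq hS⟩
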